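/- Let G be a connected decomposable claw-free graph with maximum degree 3 such that χ'_irr(G) > 3 and every decomposable claw-free graph with maximum degree at most 3 and fewer edges than G has locally irregular chromatic index at most 3. Then G contains no 4-cycle sharing an edge with each of two triangles, i.e., no configuration of a 4-cycle w_1 w_2 z_2 z_1 together with triangles u w_1 z_1 and v w_2 z_2. -/

import Mathlib

/-- A graph is *locally irregular* if no two adjacent vertices have the same degree. -/
def LocallyIrregular {V : Type*} (G : SimpleGraph V) : Prop :=
  ∀ ⦃u v : V⦄, G.Adj u v → (G.neighborSet u).ncard ≠ (G.neighborSet v).ncard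

/-- `HasLIEC G k` : `G` admits a locally irregular edge-coloring using at most `k` colors,
i.e. an assignment of one of `k` colors to every edge such that the edges of each fixed
color induce a locally irregular graph. -/
def HasLIEC {V : Type*} (G : SimpleGraph V) (k : ℕ) : Prop :=
  ∃ c : Sym2 V → Fin k, ∀ i : Fin k,
    LocallyIrregular (SimpleGraph.fromEdgeSet {e | e ∈ G.edgeSet ∧ c e = i})

/-- A graph is *decomposable* if it admits a locally irregular edge-coloring. -/
def Decomposable {V : Type*} (G : SimpleGraph V) : Prop :=
  ∃ k : ℕ, HasLIEC G k

/-- A graph is *claw-free* if it contains no induced subgraph isomorphic to `K_{1,3}`. -/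
def ClawFree {V : Type*} (G : SimpleGraph V) : Prop :=
  ¬ ∃ v a b c : V, a ≠ b ∧ a ≠ c ∧ b ≠ c ∧
      G.Adj v a ∧ G.Adj v b ∧ G.Adj v c ∧ ¬ G.Adj a b ∧ ¬ G.Adj a c ∧ ¬ G.Adj b c

/-- `G` has maximum degree at most `d`. -/
def MaxDegreeLE {V : Type*} (G : SimpleGraph V) (d : ℕ) : Prop :=
  ∀ v : V, (G.neighborSet v).ncard ≤ d


open Classical in
noncomputable def cdg {V K : Type*} (G : SimpleGraph V) (c : Sym2 V → K) (i : K) (x : V) : ℕ :=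
  {z | G.Adj x z ∧ c s(x, z) = i}.ncard

theorem nbr_color {V K : Type*} (G : SimpleGraph V) (c : Sym2 V → K) (i : K) (x : V) :
    ((SimpleGraph.fromEdgeSet {e | e ∈ G.edgeSet ∧ c e = i}).neighborSet x).ncard = cdg G c i x := by
  unfold cdg
  congr 1
  ext z
  simp only [SimpleGraph.mem_neighborSet, SimpleGraph.fromEdgeSet_adj, Set.mem_ofPred_eq,
    SimpleGraph.mem_edgeSet]
  constructor
  · rintro ⟨h, _⟩; exact h
  · intro h; exact ⟨h, h.1.ne⟩

theorem liec_iff {V : Type*} (G : SimpleGraph V) (k : ℕ) :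
    HasLIEC G k ↔ ∃ c : Sym2 V → Fin k, ∀ x y, G.Adj x y →
      cdg G c (c s(x, y)) x ≠ cdg G c (c s(x, y)) y := by
  unfold HasLIEC LocallyIrregular
  simp only [nbr_color, SimpleGraph.fromEdgeSet_adj, Set.mem_ofPred_eq, SimpleGraph.mem_edgeSet]
  constructor
  · rintro ⟨c, h⟩
    exact ⟨c, fun x y hxy => h _ ⟨⟨hxy, rfl⟩, hxy.ne⟩⟩
  · rintro ⟨c, h⟩
    refine ⟨c, fun i x y hxy => ?_⟩
    have := h x y hxy.1.1
    rwa [hxy.1.2] at this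

theorem liec_of_iso {V W : Type*} {G : SimpleGraph V} {H : SimpleGraph W} (e : G ≃g H) (k : ℕ)
    (h : HasLIEC G k) : HasLIEC H k := by
  rw [liec_iff] at *
  obtain ⟨c, hc⟩ := h
  have key : ∀ i x, cdg H (fun s => c (s.map e.symm)) i x = cdg G c i (e.symm x) := by
    intro i x
    unfold cdg
    rw [← Set.ncard_image_of_injective _ e.symm.injective]
    congr 1
    ext z
    simp only [Set.mem_image, Set.mem_ofPred_eq, Sym2.map_mk]
    constructor
    · rintro ⟨y, ⟨h1, h2⟩, rfl⟩
      exact ⟨e.symm.map_adj_iff.2 h1, h2⟩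
    · rintro ⟨h1, h2⟩
      refine ⟨e z, ⟨?_, ?_⟩, by simp⟩
      · rw [← e.map_adj_iff] at h1; simpa using h1
      · simpa using h2
  refine ⟨fun s => c (s.map e.symm), fun x y hxy => ?_⟩
  rw [key, key]
  exact hc _ _ (e.symm.map_adj_iff.2 hxy)

theorem claw_of_iso {V W : Type*} {G : SimpleGraph V} {H : SimpleGraph W} (e : G ≃g H)
    (h : ClawFree G) : ClawFree H := by
  rintro ⟨v, a, b, c, h1, h2, h3, h4, h5, h6, h7, h8, h9⟩
  refine h ⟨e.symm v, e.symm a, e.symm b, e.symm c, ?_⟩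
  simp only [e.symm.map_adj_iff, ne_eq, EmbeddingLike.apply_eq_iff_eq]
  exact ⟨h1, h2, h3, h4, h5, h6, h7, h8, h9⟩

theorem deg_of_iso {V W : Type*} {G : SimpleGraph V} {H : SimpleGraph W} (e : G ≃g H) (d : ℕ)
    (h : MaxDegreeLE G d) : MaxDegreeLE H d := by
  intro v
  have := h (e.symm v)
  rwa [← Nat.card_coe_set_eq, Nat.card_congr (e.symm.mapNeighborSet v).symm,
    Nat.card_coe_set_eq] at this

theorem card_of_iso {V W : Type*} {G : SimpleGraph V} {H : SimpleGraph W} (e : G ≃g H) :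
    H.edgeSet.ncard = G.edgeSet.ncard := by
  rw [← Nat.card_coe_set_eq, ← Nat.card_coe_set_eq, Nat.card_congr e.mapEdgeSet]

theorem min_transfer {V : Type*} [Fintype V] (n : ℕ)
    (hmin : ∀ (W : Type) [Fintype W] (H : SimpleGraph W),
      Decomposable H → ClawFree H → MaxDegreeLE H 3 →
      H.edgeSet.ncard < n → HasLIEC H 3) (H : SimpleGraph V)
    (h1 : Decomposable H) (h2 : ClawFree H) (h3 : MaxDegreeLE H 3) (h4 : H.edgeSet.ncard < n) :
    HasLIEC H 3 := by
  let e : H ≃g (H.map (Fintype.equivFin V).toEmbedding) := SimpleGraph.Iso.map _ _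
  refine liec_of_iso e.symm 3 (hmin _ _ ?_ (claw_of_iso e h2) (deg_of_iso e 3 h3) ?_)
  · obtain ⟨k, hk⟩ := h1
    exact ⟨k, liec_of_iso e k hk⟩
  · rw [card_of_iso e]; exact h4

theorem cdg_zero {V K : Type*} [Finite V] {G : SimpleGraph V} {c : Sym2 V → K} {i : K} {x : V}
    (h : ∀ y, G.Adj x y → c s(x, y) ≠ i) : cdg G c i x = 0 := by
  unfold cdg
  rw [Set.ncard_eq_zero (Set.toFinite _)]
  ext z
  simp only [Set.mem_ofPred_eq, Set.mem_empty_iff_false, iff_false, not_and]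
  exact h z

theorem cdg_pos {V K : Type*} [Finite V] {G : SimpleGraph V} {c : Sym2 V → K} {x y : V}
    (h : G.Adj x y) : 0 < cdg G c (c s(x, y)) x := by
  unfold cdg
  rw [Set.ncard_pos (Set.toFinite _)]
  exact ⟨y, h, rfl⟩

theorem cdg_uniq {V K : Type*} [Finite V] [DecidableEq K] {G : SimpleGraph V} {c : Sym2 V → K}
    {x y : V} (h : G.Adj x y) (hu : ∀ z, G.Adj x z → z = y) (i : K) :
    cdg G c i x = if c s(x, y) = i then 1 else 0 := by
  split_ifs with hc
  · unfold cdg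
    rw [Set.ncard_eq_one]
    refine ⟨y, ?_⟩
    ext z
    simp only [Set.mem_ofPred_eq, Set.mem_singleton_iff]
    exact ⟨fun hz => hu z hz.1, fun hz => hz ▸ ⟨h, hc⟩⟩
  · apply cdg_zero
    intro z hz; rw [hu z hz]; exact hc

open Classical in
theorem cdg_add {V K : Type*} [Finite V] (G : SimpleGraph V) (c : Sym2 V → K) {a b : V}
    (hab : a ≠ b) (hn : ¬ G.Adj a b) (col i : K) (x : V) :
    cdg (G ⊔ SimpleGraph.edge a b) (Function.update c s(a, b) col) i x =
      cdg G c i x + if (x = a ∨ x = b) ∧ col = i then 1 else 0 := by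
  have hupd : ∀ y z, G.Adj y z → Function.update c s(a, b) col s(y, z) = c s(y, z) := by
    intro y z hyz
    apply Function.update_of_ne
    intro h
    rw [← SimpleGraph.mem_edgeSet, h] at hyz
    exact hn hyz
  unfold cdg
  split_ifs with h
  · obtain ⟨h, rfl⟩ := h
    have aux : ∀ p q : V, p ≠ q → ¬ G.Adj p q → s(p, q) = s(a, b) →
        {z | (G ⊔ SimpleGraph.edge a b).Adj p z ∧ Function.update c s(a, b) col s(p, z) = col} =
        insert q {z | G.Adj p z ∧ c s(p, z) = col} := by
      intro p q hpq hG heq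
      ext z
      simp only [Set.mem_ofPred_eq, Set.mem_insert_iff, SimpleGraph.sup_adj]
      have : (SimpleGraph.edge a b).Adj p z ↔ z = q := by
        unfold SimpleGraph.edge
        rw [SimpleGraph.fromEdgeSet_adj, Set.mem_singleton_iff, ← heq, Sym2.congr_right]
        constructor
        · exact fun h => h.1
        · rintro rfl; exact ⟨rfl, hpq⟩
      rw [this]
      constructor
      · rintro ⟨h1 | h1, h2⟩
        · right; rw [hupd _ _ h1] at h2; exact ⟨h1, h2⟩
        · exact Or.inl h1
      · rintro (rfl | h1)
        · refine ⟨Or.inr rfl, ?_⟩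
          rw [heq, Function.update_self]
        · exact ⟨Or.inl h1.1, by rw [hupd _ _ h1.1]; exact h1.2⟩
    rcases h with rfl | rfl
    · rw [aux x b hab hn rfl, Set.ncard_insert_of_notMem _ (Set.toFinite _)]
      exact fun h => hn h.1
    · rw [aux x a hab.symm (fun h => hn h.symm) Sym2.eq_swap,
        Set.ncard_insert_of_notMem _ (Set.toFinite _)]
      exact fun h => hn h.1.symm
  · rw [add_zero]
    congr 1
    ext z
    simp only [Set.mem_ofPred_eq, SimpleGraph.sup_adj]
    constructor
    · rintro ⟨h1 | h1, h2⟩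
      · rw [hupd _ _ h1] at h2; exact ⟨h1, h2⟩
      · exfalso
        rw [SimpleGraph.edge_adj] at h1
        have hs : s(x, z) = s(a, b) := by
          rw [Sym2.eq_iff]; exact h1.1
        rw [hs, Function.update_self] at h2
        apply h
        exact ⟨h1.1.imp And.left And.left, h2⟩
    · rintro ⟨h1, h2⟩
      exact ⟨Or.inl h1, by rw [hupd _ _ h1]; exact h2⟩

def GoodC {V K : Type*} (G : SimpleGraph V) (S : Set V) (c : Sym2 V → K) : Prop :=
  ∀ x y, G.Adj x y → cdg G c (c s(x, y)) x ≠ cdg G c (c s(x, y)) y ∨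
    ((x ∈ S ∨ y ∈ S) ∧ cdg G c (c s(x, y)) x = 1 ∧ cdg G c (c s(x, y)) y = 1)

theorem good_step {V : Type*} [Finite V] (E K : SimpleGraph V) (S : Set V) (c : Sym2 V → Fin 3)
    (u : V) (hu : u ∈ S) (huniq : ∀ y y', E.Adj u y → E.Adj u y' → y = y')
    (hdeg : MaxDegreeLE E 3) (hK : K ≤ E) (hg : GoodC K S c) :
    ∃ (K' : SimpleGraph V) (c' : Sym2 V → Fin 3), K ≤ K' ∧ K' ≤ E ∧
      (∀ y, E.Adj u y → K'.Adj u y) ∧ GoodC K' S c' := by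
  classical
  by_cases hall : ∀ y, E.Adj u y → K.Adj u y
  · exact ⟨K, c, le_rfl, hK, hall, hg⟩
  push Not at hall
  obtain ⟨y, hy, hny⟩ := hall
  have hiso : ∀ z, ¬ K.Adj u z := by
    intro z hz
    rw [huniq z y (hK hz) hy] at hz
    exact hny hz
  -- choose color
  have hcol : ∃ β : Fin 3, ∀ z, K.Adj y z → c s(y, z) ≠ β := by
    by_contra hcon
    push Not at hcon
    choose g hg1 hg2 using hcon
    have hinj : Function.Injective g := by
      intro i j hij
      rw [← hg2 i, ← hg2 j, hij]
    have h4 : (insert u (Set.range g)).ncard = 4 := by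
      rw [Set.ncard_insert_of_notMem _ (Set.toFinite _), ← Set.image_univ,
        Set.ncard_image_of_injective _ hinj, Set.ncard_univ]
      · simp
      · rintro ⟨i, hi⟩
        have := hg1 i
        rw [hi] at this
        exact hiso _ this.symm
    have hsub : insert u (Set.range g) ⊆ E.neighborSet y := by
      rintro z (rfl | ⟨i, rfl⟩)
      · exact hy.symm
      · exact hK (hg1 i)
    have := Set.ncard_le_ncard hsub (Set.toFinite _)
    have := hdeg y
    omega
  obtain ⟨β, hβ⟩ := hcol
  have hne : u ≠ y := hy.ne
  refine ⟨K ⊔ SimpleGraph.edge u y, Function.update c s(u, y) β, le_sup_left, ?_, ?_, ?_⟩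
  · apply sup_le hK
    intro p q hpq
    rw [SimpleGraph.edge_adj] at hpq
    rcases hpq.1 with ⟨rfl, rfl⟩ | ⟨rfl, rfl⟩
    · exact hy
    · exact hy.symm
  · intro z hz
    rw [huniq z y hz hy]
    right
    rw [SimpleGraph.edge_adj]
    exact ⟨Or.inl ⟨rfl, rfl⟩, hne⟩
  · have hu0 : cdg K c β u = 0 := cdg_zero fun z hz => absurd hz (hiso z)
    have hy0 : cdg K c β y = 0 := cdg_zero hβ
    intro p q hpq
    rw [SimpleGraph.sup_adj] at hpq
    rcases hpq with hpq | hpq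
    · have hs : s(p, q) ≠ s(u, y) := by
        intro h
        rw [← SimpleGraph.mem_edgeSet, h] at hpq
        exact hny hpq
      rw [Function.update_of_ne hs, cdg_add _ _ hne hny, cdg_add _ _ hne hny]
      have hp := cdg_pos (c := c) hpq
      have hq := cdg_pos (c := c) hpq.symm
      rw [Sym2.eq_swap] at hq
      rw [if_neg, if_neg]
      · exact hg p q hpq
      · rintro ⟨rfl | rfl, h⟩ <;> rw [← h] at hq <;> omega
      · rintro ⟨rfl | rfl, h⟩ <;> rw [← h] at hp <;> omega
    · right
      rw [SimpleGraph.edge_adj] at hpq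
      rcases hpq.1 with ⟨rfl, rfl⟩ | ⟨rfl, rfl⟩
      · refine ⟨Or.inl hu, ?_⟩
        rw [Function.update_self, cdg_add _ _ hne hny, cdg_add _ _ hne hny]
        simp [hu0, hy0]
      · refine ⟨Or.inr hu, ?_⟩
        rw [show s(p, q) = s(q, p) from Sym2.eq_swap, Function.update_self, cdg_add _ _ hne hny, cdg_add _ _ hne hny]
        simp [hu0, hy0]

theorem pairing {α : Type*} (F : Finset α) (h : Even F.card) :
    ∃ g : α → ℕ, (∀ e, g e ≤ F.card) ∧ ∀ e ∈ F, ∃ e' ∈ F, e' ≠ e ∧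
      ∀ e'' ∈ F, g e'' = g e ↔ (e'' = e ∨ e'' = e') := by
  classical
  obtain ⟨m, hm⟩ := h
  let φ := F.equivFin
  refine ⟨fun e => if he : e ∈ F then (φ ⟨e, he⟩).1 / 2 else 0, ?_, ?_⟩
  · intro e
    dsimp only
    split_ifs with he
    · have := (φ ⟨e, he⟩).2; omega
    · omega
  · intro e he
    have hlt := (φ ⟨e, he⟩).2
    let k := (φ ⟨e, he⟩).1
    have hk' : (if k % 2 = 0 then k + 1 else k - 1) < F.card := by
      have : k < F.card := hlt
      split_ifs <;> omega
    let k' : Fin F.card := ⟨_, hk'⟩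
    refine ⟨(φ.symm k').1, (φ.symm k').2, ?_, ?_⟩
    · intro hh
      have h2 : φ.symm k' = ⟨e, he⟩ := Subtype.ext hh
      rw [Equiv.symm_apply_eq] at h2
      have h3 : (if k % 2 = 0 then k + 1 else k - 1) = k := congrArg Fin.val h2
      split_ifs at h3 <;> omega
    · intro e'' he''
      dsimp only
      rw [dif_pos he, dif_pos he'']
      have i1 : e'' = e ↔ (φ ⟨e'', he''⟩).1 = k := by
        rw [← Fin.ext_iff, φ.apply_eq_iff_eq, Subtype.mk.injEq]
      have i2 : e'' = (φ.symm k').1 ↔ (φ ⟨e'', he''⟩).1 = if k % 2 = 0 then k + 1 else k - 1 := by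
        have : (φ ⟨e'', he''⟩).1 = (if k % 2 = 0 then k + 1 else k - 1) ↔ φ ⟨e'', he''⟩ = k' :=
          (Fin.ext_iff (a := φ ⟨e'', he''⟩) (b := k')).symm
        rw [this, ← Equiv.eq_symm_apply, Subtype.ext_iff]
      rw [i1, i2]
      change (φ ⟨e'', he''⟩).1 / 2 = k / 2 ↔ _
      split_ifs <;> omega

theorem dec_of_finite {V K : Type*} [Finite K] (G : SimpleGraph V) (c : Sym2 V → K)
    (h : ∀ x y, G.Adj x y → cdg G c (c s(x, y)) x ≠ cdg G c (c s(x, y)) y) : Decomposable G := by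
  obtain ⟨n, ⟨e⟩⟩ := Finite.exists_equiv_fin K
  refine ⟨n, (liec_iff _ _).2 ⟨fun s => e (c s), fun x y hxy => ?_⟩⟩
  have := h x y hxy
  unfold cdg at *
  simpa only [e.apply_eq_iff_eq] using this

open Classical in
theorem dec_of_orient {V : Type*} [Fintype V] (H : SimpleGraph V) (f : Sym2 V → V)
    (hf : ∀ e ∈ H.edgeSet, f e ∈ e)
    (hev : ∀ x, Even (Finset.univ.filter (fun e => e ∈ H.edgeSet ∧ f e = x)).card) :
    Decomposable H := by
  have hp := fun x => pairing _ (hev x)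
  choose g hg1 hg2 using hp
  have hb : ∀ x e, g x e < Fintype.card (Sym2 V) + 1 := by
    intro x e
    have := hg1 x e
    have h2 := Finset.card_le_univ (Finset.univ.filter (fun e => e ∈ H.edgeSet ∧ f e = x))
    omega
  let c : Sym2 V → V × Fin (Fintype.card (Sym2 V) + 1) := fun e => (f e, ⟨g (f e) e, hb _ _⟩)
  apply dec_of_finite H c
  -- key: for an edge s(x,y) with f = x, degrees are 2 and 1
  have key : ∀ x y, H.Adj x y → f s(x, y) = x →
      cdg H c (c s(x, y)) x = 2 ∧ cdg H c (c s(x, y)) y = 1 := by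
    intro x y hxy hfx
    obtain ⟨e', he', hne, hiff⟩ := hg2 x s(x, y) (by simp [hxy, hfx])
    simp only [Finset.mem_filter, Finset.mem_univ, true_and] at he' hiff
    have hx' : x ∈ e' := by
      have := hf e' he'.1; rwa [he'.2] at this
    obtain ⟨z, rfl⟩ := hx'
    have hzy : z ≠ y := fun h => hne (by rw [h])
    have hcol : ∀ e ∈ H.edgeSet, c e = c s(x, y) ↔ (e = s(x, y) ∨ e = s(x, z)) := by
      intro e he
      simp only [c, Prod.mk.injEq, Fin.mk.injEq]
      constructor
      · rintro ⟨h1, h2⟩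
        rw [h1, hfx] at h2
        exact (hiff e ⟨he, by rw [h1, hfx]⟩).1 h2
      · intro h
        have hfe : f e = x := by
          rcases h with rfl | rfl
          · exact hfx
          · exact he'.2
        refine ⟨by rw [hfe, hfx], ?_⟩
        rw [hfe, hfx]
        exact (hiff e ⟨he, hfe⟩).2 h
    have hxz : H.Adj x z := he'.1
    unfold cdg
    constructor
    · rw [Set.ncard_eq_two]
      refine ⟨y, z, hzy.symm, ?_⟩
      ext t
      simp only [Set.mem_ofPred_eq, Set.mem_insert_iff, Set.mem_singleton_iff]
      constructor
      · rintro ⟨h1, h2⟩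
        rw [hcol _ h1, Sym2.congr_right, Sym2.congr_right] at h2
        exact h2
      · rintro (rfl | rfl)
        · exact ⟨hxy, rfl⟩
        · exact ⟨hxz, (hcol _ hxz).2 (Or.inr rfl)⟩
    · rw [Set.ncard_eq_one]
      refine ⟨x, ?_⟩
      ext t
      simp only [Set.mem_ofPred_eq, Set.mem_singleton_iff]
      constructor
      · rintro ⟨h1, h2⟩
        rw [hcol _ h1, Sym2.eq_iff, Sym2.eq_iff] at h2
        have := hxy.ne
        grind
      · rintro rfl
        exact ⟨hxy.symm, by rw [Sym2.eq_swap]⟩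
  intro x y hxy
  have := hf s(x, y) hxy
  rw [Sym2.mem_iff] at this
  rcases this with h | h
  · obtain ⟨h1, h2⟩ := key x y hxy h
    omega
  · rw [Sym2.eq_swap] at h ⊢
    obtain ⟨h1, h2⟩ := key y x hxy.symm h
    omega

open Classical in
noncomputable def par {V : Type*} [Fintype V] (E : SimpleGraph V) (f : Sym2 V → V) (x : V) : ZMod 2 :=
  ∑ e : Sym2 V, if e ∈ E.edgeSet ∧ f e = x then 1 else 0

open Classical in
theorem par_eq {V : Type*} [Fintype V] (E : SimpleGraph V) (f : Sym2 V → V) (x : V) :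
    par E f x = 0 ↔ Even (Finset.univ.filter (fun e => e ∈ E.edgeSet ∧ f e = x)).card := by
  unfold par
  rw [Finset.sum_boole, ZMod.natCast_eq_zero_iff_even]

open Classical in
theorem flip_edge {V : Type*} [Fintype V] (E : SimpleGraph V) (f : Sym2 V → V)
    (hf : ∀ e ∈ E.edgeSet, f e ∈ e) (a b : V) (hab : E.Adj a b) :
    ∃ f' : Sym2 V → V, (∀ e ∈ E.edgeSet, f' e ∈ e) ∧ ∀ x, par E f' x =
      par E f x + (if x = a then 1 else 0) + (if x = b then 1 else 0) := by
  have hne := hab.ne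
  have h0 := hf s(a, b) hab
  rw [Sym2.mem_iff] at h0
  refine ⟨Function.update f s(a, b) (if f s(a, b) = a then b else a), ?_, ?_⟩
  · intro e he
    by_cases h : e = s(a, b)
    · subst h
      rw [Function.update_self]
      split_ifs <;> simp
    · rw [Function.update_of_ne h]; exact hf e he
  · intro x
    unfold par
    rw [← Finset.add_sum_erase _ _ (Finset.mem_univ s(a, b)),
      ← Finset.add_sum_erase (a := s(a, b)) _ (fun e => if e ∈ E.edgeSet ∧ f e = x then (1 : ZMod 2) else 0)
        (Finset.mem_univ s(a, b))]
    rw [Finset.sum_congr rfl (g := fun e => if e ∈ E.edgeSet ∧ f e = x then (1 : ZMod 2) else 0)]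
    · have two : (1 : ZMod 2) + 1 = 0 := by decide
      simp only [Function.update_self, SimpleGraph.mem_edgeSet, hab, true_and]
      generalize ∑ e ∈ Finset.univ.erase s(a, b), (if e ∈ E.edgeSet ∧ f e = x then (1 : ZMod 2) else 0) = t
      rcases h0 with h0 | h0
      · rw [h0, if_pos rfl]
        by_cases h1 : x = a
        · subst h1
          simp [hne, hne.symm]
          linear_combination -two
        · by_cases h2 : x = b
          · subst h2; simp [hne, hne.symm]; ring
          · simp [h1, h2, Ne.symm h1, Ne.symm h2]
      · rw [h0, if_neg hne.symm]
        by_cases h1 : x = a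
        · subst h1
          simp [hne, hne.symm]
          ring
        · by_cases h2 : x = b
          · subst h2; simp [hne, hne.symm]; linear_combination -two
          · simp [h1, h2, Ne.symm h1, Ne.symm h2]
    · intro e he
      rw [Function.update_of_ne (Finset.ne_of_mem_erase he)]

open Classical in
theorem flip_path {V : Type*} [Fintype V] (E : SimpleGraph V) (a b : V) (hab : E.Reachable a b) :
    ∀ (f : Sym2 V → V) (_ : ∀ e ∈ E.edgeSet, f e ∈ e),
    ∃ f' : Sym2 V → V, (∀ e ∈ E.edgeSet, f' e ∈ e) ∧ ∀ x, par E f' x =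
      par E f x + (if x = a then 1 else 0) + (if x = b then 1 else 0) := by
  have two : (1 : ZMod 2) + 1 = 0 := by decide
  obtain ⟨p⟩ := hab
  induction p with
  | nil =>
    intro f hf
    refine ⟨f, hf, fun x => ?_⟩
    split_ifs
    · linear_combination -two
    · simp
  | @cons a m b h p ih =>
    intro f hf
    obtain ⟨f1, h1, h2⟩ := flip_edge E f hf a m h
    obtain ⟨f2, h3, h4⟩ := ih f1 h1
    refine ⟨f2, h3, fun x => ?_⟩
    rw [h4, h2]
    have : (if x = m then (1 : ZMod 2) else 0) + (if x = m then 1 else 0) = 0 := by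
      split_ifs
      · exact two
      · simp
    linear_combination this

theorem exists_orient {V : Type*} [Fintype V] (E : SimpleGraph V) (u v : V)
    (hr : ∀ x, (∀ y, ¬ E.Adj x y) ∨ E.Reachable x u ∨ E.Reachable x v) :
    ∃ f : Sym2 V → V, (∀ e ∈ E.edgeSet, f e ∈ e) ∧ ∀ x, x ≠ u → x ≠ v → par E f x = 0 := by
  classical
  have main : ∀ T : Finset V, u ∉ T → v ∉ T →
      ∃ f : Sym2 V → V, (∀ e ∈ E.edgeSet, f e ∈ e) ∧ ∀ x ∈ T, par E f x = 0 := by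
    intro T
    induction T using Finset.induction_on with
    | empty =>
      intro _ _
      refine ⟨fun e => e.out.1, fun e _ => Sym2.out_fst_mem e, by simp⟩
    | insert a T ha ih =>
      intro hu hv
      simp only [Finset.mem_insert, not_or] at hu hv
      obtain ⟨f, hf, h0⟩ := ih hu.2 hv.2
      by_cases hpa : par E f a = 0
      · refine ⟨f, hf, ?_⟩
        intro x hx
        rcases Finset.mem_insert.1 hx with rfl | hx
        · exact hpa
        · exact h0 x hx
      have hpa1 : par E f a = 1 := by
        generalize par E f a = t at hpa
        revert t; decide
      have two : (1 : ZMod 2) + 1 = 0 := by decide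
      have fin : ∀ r, E.Reachable a r → a ≠ r → r ∉ T →
          ∃ f : Sym2 V → V, (∀ e ∈ E.edgeSet, f e ∈ e) ∧ ∀ x ∈ insert a T, par E f x = 0 := by
        intro r har hne hrT
        obtain ⟨f', hf', hp'⟩ := flip_path E a r har f hf
        refine ⟨f', hf', fun x hx => ?_⟩
        rw [hp']
        rcases Finset.mem_insert.1 hx with rfl | hx
        · rw [hpa1, if_pos rfl, if_neg hne, two, add_zero]
        · rw [h0 x hx, if_neg, if_neg]
          · simp
          · rintro rfl; exact hrT hx
          · intro h; exact ha (h ▸ hx)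
      rcases hr a with h | h | h
      · exfalso
        apply hpa
        unfold par
        apply Finset.sum_eq_zero
        intro e _
        rw [if_neg]
        rintro ⟨he, hfe⟩
        have := hf e he
        rw [hfe] at this
        obtain ⟨z, rfl⟩ := this
        exact h z he
      · exact fin u h (Ne.symm hu.1) hu.2
      · exact fin v h (Ne.symm hv.1) hv.2
  obtain ⟨f, hf, h⟩ := main (Finset.univ.filter fun x => x ≠ u ∧ x ≠ v) (by simp) (by simp)
  exact ⟨f, hf, fun x h1 h2 => h x (by simp [h1, h2])⟩

def ind3 (p i : Fin 3) : ℕ := if p = i then 1 else 0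

def okT (tu tv : Fin 4) (al be A B C D E F G I : Fin 3) : Prop :=
  let du := fun i => (if tu = 0 then 0 else ind3 al i) + ind3 E i + ind3 F i
  let dv := fun i => (if tv = 0 then 0 else ind3 be i) + ind3 G i + ind3 I i
  let dw1 := fun i => ind3 A i + ind3 D i + ind3 E i
  let dw2 := fun i => ind3 A i + ind3 B i + ind3 G i
  let dz1 := fun i => ind3 C i + ind3 D i + ind3 F i
  let dz2 := fun i => ind3 B i + ind3 C i + ind3 I i
  dw1 A ≠ dw2 A ∧ dw2 B ≠ dz2 B ∧ dz2 C ≠ dz1 C ∧ dz1 D ≠ dw1 D ∧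
  du E ≠ dw1 E ∧ du F ≠ dz1 F ∧ dv G ≠ dw2 G ∧ dv I ≠ dz2 I ∧
  (tu = 1 → du al = 1) ∧ (tu = 2 → du al ≠ 1) ∧ (tv = 1 → dv be = 1) ∧ (tv = 2 → dv be ≠ 1) ∧
  (tu = 3 → du al ≠ dv be)

instance (tu tv : Fin 4) (al be A B C D E F G I : Fin 3) :
    Decidable (okT tu tv al be A B C D E F G I) := by
  unfold okT; infer_instance

def tab9 : List (Fin 3 × Fin 3 × Fin 3 × Fin 3 × Fin 3 × Fin 3 × Fin 3 × Fin 3) :=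
  [(0, 0, 1, 1, 2, 2, 2, 2), (0, 0, 2, 2, 1, 1, 1, 1), (1, 1, 2, 2, 0, 0, 0, 0),
   (0, 0, 1, 0, 0, 1, 2, 2), (0, 0, 1, 0, 2, 2, 0, 1), (0, 0, 2, 0, 0, 2, 1, 1),
   (0, 0, 2, 0, 1, 1, 0, 2), (0, 0, 0, 0, 0, 1, 2, 0), (0, 0, 0, 0, 0, 2, 1, 0)]

set_option maxRecDepth 100000 in
theorem table_all : ∀ (al be : Fin 3) (tu tv : Fin 3), ∃ t ∈ tab9,
    okT tu.castSucc tv.castSucc al be t.1 t.2.1 t.2.2.1 t.2.2.2.1 t.2.2.2.2.1 t.2.2.2.2.2.1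
      t.2.2.2.2.2.2.1 t.2.2.2.2.2.2.2 := by
  decide

theorem table_prism : okT 3 3 0 0 0 0 1 0 0 1 2 2 := by decide

open Classical in
theorem add_one_edge {V K : Type*} [Finite V] (G : SimpleGraph V) (c : Sym2 V → K) {a b : V}
    (hab : a ≠ b) (hn : ¬ G.Adj a b) (col : K) :
    ∃ c' : Sym2 V → K, (∀ i x, cdg (G ⊔ SimpleGraph.edge a b) c' i x =
      cdg G c i x + if (x = a ∨ x = b) ∧ col = i then 1 else 0) ∧ c' s(a, b) = col ∧
      ∀ e, e ≠ s(a, b) → c' e = c e :=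
  ⟨Function.update c s(a, b) col, fun i x => cdg_add G c hab hn col i x,
    Function.update_self _ _ _, fun _ he => Function.update_of_ne he _ _⟩

open Classical in
theorem ext8 {V : Type*} [Finite V] (E0 : SimpleGraph V) (c0 : Sym2 V → Fin 3)
    (u v w1 w2 z1 z2 : V) (hd : List.Pairwise (· ≠ ·) [u, v, w1, w2, z1, z2])
    (hw1 : ∀ y, ¬ E0.Adj w1 y) (hw2 : ∀ y, ¬ E0.Adj w2 y)
    (hz1 : ∀ y, ¬ E0.Adj z1 y) (hz2 : ∀ y, ¬ E0.Adj z2 y)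
    (A B C D E F H I : Fin 3) :
    ∃ c : Sym2 V → Fin 3,
      (∀ i x, cdg (E0 ⊔ SimpleGraph.edge w1 w2 ⊔ SimpleGraph.edge w2 z2 ⊔ SimpleGraph.edge z2 z1
        ⊔ SimpleGraph.edge z1 w1 ⊔ SimpleGraph.edge u w1 ⊔ SimpleGraph.edge u z1
        ⊔ SimpleGraph.edge v w2 ⊔ SimpleGraph.edge v z2) c i x = cdg E0 c0 i x
        + (if (x = w1 ∨ x = w2) ∧ A = i then 1 else 0)
        + (if (x = w2 ∨ x = z2) ∧ B = i then 1 else 0)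
        + (if (x = z2 ∨ x = z1) ∧ C = i then 1 else 0)
        + (if (x = z1 ∨ x = w1) ∧ D = i then 1 else 0)
        + (if (x = u ∨ x = w1) ∧ E = i then 1 else 0)
        + (if (x = u ∨ x = z1) ∧ F = i then 1 else 0)
        + (if (x = v ∨ x = w2) ∧ H = i then 1 else 0)
        + (if (x = v ∨ x = z2) ∧ I = i then 1 else 0)) ∧
      c s(w1, w2) = A ∧ c s(w2, z2) = B ∧ c s(z2, z1) = C ∧ c s(z1, w1) = D ∧
      c s(u, w1) = E ∧ c s(u, z1) = F ∧ c s(v, w2) = H ∧ c s(v, z2) = I ∧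
      ∀ x y, E0.Adj x y → c s(x, y) = c0 s(x, y) := by
  simp only [List.pairwise_cons, List.mem_cons, List.not_mem_nil, or_false, forall_eq_or_imp,
    forall_eq, IsEmpty.forall_iff, implies_true, List.Pairwise.nil, and_true] at hd
  obtain ⟨⟨uv, uw1, uw2, uz1, uz2⟩, ⟨vw1, vw2, vz1, vz2⟩, ⟨w12, w1z1, w1z2⟩, ⟨w2z1, w2z2⟩, z12⟩ := hd
  have hw1' : ∀ y, ¬ E0.Adj y w1 := fun y h => hw1 y h.symm
  have hw2' : ∀ y, ¬ E0.Adj y w2 := fun y h => hw2 y h.symm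
  have hz1' : ∀ y, ¬ E0.Adj y z1 := fun y h => hz1 y h.symm
  have hz2' : ∀ y, ¬ E0.Adj y z2 := fun y h => hz2 y h.symm
  have := uv.symm; have := uw1.symm; have := uw2.symm; have := uz1.symm; have := uz2.symm
  have := vw1.symm; have := vw2.symm; have := vz1.symm; have := vz2.symm
  have := w12.symm; have := w1z1.symm; have := w1z2.symm; have := w2z1.symm; have := w2z2.symm
  have := z12.symm
  obtain ⟨c1, f1, g1, k1⟩ := add_one_edge E0 c0 w12 (hw1 _) A
  obtain ⟨c2, f2, g2, k2⟩ := add_one_edge _ c1 w2z2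
    (by simp [SimpleGraph.edge_adj, *] : ¬ (E0 ⊔ SimpleGraph.edge w1 w2).Adj w2 z2) B
  obtain ⟨c3, f3, g3, k3⟩ := add_one_edge _ c2 z12.symm
    (by simp [SimpleGraph.edge_adj, *] : ¬ (E0 ⊔ SimpleGraph.edge w1 w2 ⊔ SimpleGraph.edge w2 z2).Adj z2 z1) C
  obtain ⟨c4, f4, g4, k4⟩ := add_one_edge _ c3 w1z1.symm
    (by simp [SimpleGraph.edge_adj, *] : ¬ (E0 ⊔ SimpleGraph.edge w1 w2 ⊔ SimpleGraph.edge w2 z2 ⊔ SimpleGraph.edge z2 z1).Adj z1 w1) D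
  obtain ⟨c5, f5, g5, k5⟩ := add_one_edge _ c4 uw1
    (by simp [SimpleGraph.edge_adj, *] : ¬ (E0 ⊔ SimpleGraph.edge w1 w2 ⊔ SimpleGraph.edge w2 z2 ⊔ SimpleGraph.edge z2 z1
      ⊔ SimpleGraph.edge z1 w1).Adj u w1) E
  obtain ⟨c6, f6, g6, k6⟩ := add_one_edge _ c5 uz1
    (by simp [SimpleGraph.edge_adj, *] : ¬ (E0 ⊔ SimpleGraph.edge w1 w2 ⊔ SimpleGraph.edge w2 z2 ⊔ SimpleGraph.edge z2 z1
      ⊔ SimpleGraph.edge z1 w1 ⊔ SimpleGraph.edge u w1).Adj u z1) F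
  obtain ⟨c7, f7, g7, k7⟩ := add_one_edge _ c6 vw2
    (by simp [SimpleGraph.edge_adj, *] : ¬ (E0 ⊔ SimpleGraph.edge w1 w2 ⊔ SimpleGraph.edge w2 z2 ⊔ SimpleGraph.edge z2 z1
      ⊔ SimpleGraph.edge z1 w1 ⊔ SimpleGraph.edge u w1 ⊔ SimpleGraph.edge u z1).Adj v w2) H
  obtain ⟨c8, f8, g8, k8⟩ := add_one_edge _ c7 vz2
    (by simp [SimpleGraph.edge_adj, *] : ¬ (E0 ⊔ SimpleGraph.edge w1 w2 ⊔ SimpleGraph.edge w2 z2 ⊔ SimpleGraph.edge z2 z1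
      ⊔ SimpleGraph.edge z1 w1 ⊔ SimpleGraph.edge u w1 ⊔ SimpleGraph.edge u z1
      ⊔ SimpleGraph.edge v w2).Adj v z2) I
  refine ⟨c8, ?_, ?_, ?_, ?_, ?_, ?_, ?_, ?_, g8, ?_⟩
  · intro i x
    rw [f8, f7, f6, f5, f4, f3, f2, f1]
    congr!
  · rw [k8, k7, k6, k5, k4, k3, k2, g1] <;> simp [*]
  · rw [k8, k7, k6, k5, k4, k3, g2] <;> simp [*]
  · rw [k8, k7, k6, k5, k4, g3] <;> simp [*]
  · rw [k8, k7, k6, k5, g4] <;> simp [*]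
  · rw [k8, k7, k6, g5] <;> simp [*]
  · rw [k8, k7, g6] <;> simp [*]
  · rw [k8, g7] <;> simp [*]
  · intro x y hxy
    have q1 : x ≠ w1 := by rintro rfl; exact hw1 _ hxy
    have q2 : x ≠ w2 := by rintro rfl; exact hw2 _ hxy
    have q3 : x ≠ z1 := by rintro rfl; exact hz1 _ hxy
    have q4 : x ≠ z2 := by rintro rfl; exact hz2 _ hxy
    have q5 : y ≠ w1 := by rintro rfl; exact hw1 _ hxy.symm
    have q6 : y ≠ w2 := by rintro rfl; exact hw2 _ hxy.symm
    have q7 : y ≠ z1 := by rintro rfl; exact hz1 _ hxy.symm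
    have q8 : y ≠ z2 := by rintro rfl; exact hz2 _ hxy.symm
    rw [k8, k7, k6, k5, k4, k3, k2, k1] <;>
      simp only [ne_eq, Sym2.eq_iff, q1, q2, q3, q4, q5, q6, q7, q8, and_false, false_and, or_false,
        not_false_eq_true]

theorem finish_block {V : Type*} [Finite V] (E0 : SimpleGraph V) (c0 : Sym2 V → Fin 3)
    (u v w1 w2 z1 z2 : V) (hd : List.Pairwise (· ≠ ·) [u, v, w1, w2, z1, z2])
    (hw1 : ∀ y, ¬ E0.Adj w1 y) (hw2 : ∀ y, ¬ E0.Adj w2 y)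
    (hz1 : ∀ y, ¬ E0.Adj z1 y) (hz2 : ∀ y, ¬ E0.Adj z2 y)
    (tu tv : Fin 4) (al be A B C D E F H I : Fin 3)
    (ht : okT tu tv al be A B C D E F H I)
    (hu0 : ∀ i, cdg E0 c0 i u = if tu = 0 then 0 else ind3 al i)
    (hv0 : ∀ i, cdg E0 c0 i v = if tv = 0 then 0 else ind3 be i)
    (hE : ∀ x y, E0.Adj x y → x ≠ u → x ≠ v → y ≠ u → y ≠ v →
      cdg E0 c0 (c0 s(x, y)) x ≠ cdg E0 c0 (c0 s(x, y)) y)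
    (hEu : ∀ y, E0.Adj u y → y ≠ v → c0 s(u, y) = al ∧
      ((tu = 1 ∧ cdg E0 c0 al y ≠ 1) ∨ (tu = 2 ∧ cdg E0 c0 al y = 1)))
    (hEv : ∀ y, E0.Adj v y → y ≠ u → c0 s(v, y) = be ∧
      ((tv = 1 ∧ cdg E0 c0 be y ≠ 1) ∨ (tv = 2 ∧ cdg E0 c0 be y = 1)))
    (hEuv : E0.Adj u v → tu = 3 ∧ c0 s(u, v) = al ∧ al = be) :
    HasLIEC (E0 ⊔ SimpleGraph.edge w1 w2 ⊔ SimpleGraph.edge w2 z2 ⊔ SimpleGraph.edge z2 z1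
        ⊔ SimpleGraph.edge z1 w1 ⊔ SimpleGraph.edge u w1 ⊔ SimpleGraph.edge u z1
        ⊔ SimpleGraph.edge v w2 ⊔ SimpleGraph.edge v z2) 3 := by
  classical
  obtain ⟨c, hc, cA, cB, cC, cD, cE, cF, cH, cI, c00⟩ :=
    ext8 E0 c0 u v w1 w2 z1 z2 hd hw1 hw2 hz1 hz2 A B C D E F H I
  rw [liec_iff]
  refine ⟨c, ?_⟩
  simp only [List.pairwise_cons, List.mem_cons, List.not_mem_nil, or_false, forall_eq_or_imp,
    forall_eq, IsEmpty.forall_iff, implies_true, List.Pairwise.nil, and_true] at hd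
  obtain ⟨⟨uv, uw1, uw2, uz1, uz2⟩, ⟨vw1, vw2, vz1, vz2⟩, ⟨w12, w1z1, w1z2⟩, ⟨w2z1, w2z2⟩, z12⟩ := hd
  generalize hGG : (E0 ⊔ SimpleGraph.edge w1 w2 ⊔ SimpleGraph.edge w2 z2 ⊔ SimpleGraph.edge z2 z1
        ⊔ SimpleGraph.edge z1 w1 ⊔ SimpleGraph.edge u w1 ⊔ SimpleGraph.edge u z1
        ⊔ SimpleGraph.edge v w2 ⊔ SimpleGraph.edge v z2) = GG at *
  have du : ∀ i, cdg GG c i u = (if tu = 0 then 0 else ind3 al i) + ind3 E i + ind3 F i := by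
    intro i; rw [hc, hu0]; simp [ind3, uv, uw1, uw2, uz1, uz2]
  have dv : ∀ i, cdg GG c i v = (if tv = 0 then 0 else ind3 be i) + ind3 H i + ind3 I i := by
    intro i; rw [hc, hv0]; simp [ind3, uv.symm, vw1, vw2, vz1, vz2]
  have dw1 : ∀ i, cdg GG c i w1 = ind3 A i + ind3 D i + ind3 E i := by
    intro i; rw [hc, cdg_zero fun y hy => absurd hy (hw1 y)]
    simp [ind3, uw1.symm, vw1.symm, w12, w1z1, w1z2]
  have dw2 : ∀ i, cdg GG c i w2 = ind3 A i + ind3 B i + ind3 H i := by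
    intro i; rw [hc, cdg_zero fun y hy => absurd hy (hw2 y)]
    simp [ind3, uw2.symm, vw2.symm, w12.symm, w2z1, w2z2]
  have dz1 : ∀ i, cdg GG c i z1 = ind3 C i + ind3 D i + ind3 F i := by
    intro i; rw [hc, cdg_zero fun y hy => absurd hy (hz1 y)]
    simp [ind3, uz1.symm, vz1.symm, w1z1.symm, w2z1.symm, z12]
  have dz2 : ∀ i, cdg GG c i z2 = ind3 B i + ind3 C i + ind3 I i := by
    intro i; rw [hc, cdg_zero fun y hy => absurd hy (hz2 y)]
    simp [ind3, uz2.symm, vz2.symm, w1z2.symm, w2z2.symm, z12.symm]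
  have dout : ∀ i x, x ≠ u → x ≠ v → (∃ y, E0.Adj x y) → cdg GG c i x = cdg E0 c0 i x := by
    rintro i x h1 h2 ⟨y, hy⟩
    have q1 : x ≠ w1 := by rintro rfl; exact hw1 _ hy
    have q2 : x ≠ w2 := by rintro rfl; exact hw2 _ hy
    have q3 : x ≠ z1 := by rintro rfl; exact hz1 _ hy
    have q4 : x ≠ z2 := by rintro rfl; exact hz2 _ hy
    rw [hc]; simp [*]
  obtain ⟨tA, tB, tC, tD, tE, tF, tH, tI, t1, t2, t3, t4, t5⟩ := ht
  dsimp only at t1 t2 t3 t4 t5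
  rw [← du al] at t1 t2
  rw [← dv be] at t3 t4
  rw [← du al, ← dv be] at t5
  have hsym : ∀ x y, cdg GG c (c s(x, y)) x ≠ cdg GG c (c s(x, y)) y →
      cdg GG c (c s(y, x)) y ≠ cdg GG c (c s(y, x)) x := by
    intro x y h
    rw [show s(y, x) = s(x, y) from Sym2.eq_swap]
    exact h.symm
  have hu : ∀ y, E0.Adj u y → cdg GG c (c s(u, y)) u ≠ cdg GG c (c s(u, y)) y := by
    intro y hy
    rw [c00 _ _ hy]
    by_cases hyv : y = v
    · subst hyv
      obtain ⟨h1, h2, h3⟩ := hEuv hy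
      rw [h2]
      have := t5 h1
      rwa [← h3] at this
    · obtain ⟨h1, h2⟩ := hEu y hy hyv
      rw [h1, dout al y hy.ne' hyv ⟨u, hy.symm⟩]
      rcases h2 with ⟨h2, h3⟩ | ⟨h2, h3⟩
      · rw [t1 h2]; exact h3.symm
      · rw [h3]; exact t2 h2
  have hv : ∀ y, E0.Adj v y → cdg GG c (c s(v, y)) v ≠ cdg GG c (c s(v, y)) y := by
    intro y hy
    by_cases hyv : y = u
    · subst hyv
      exact hsym _ _ (hu _ hy.symm)
    · rw [c00 _ _ hy]
      obtain ⟨h1, h2⟩ := hEv y hy hyv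
      rw [h1, dout be y hyv hy.ne' ⟨v, hy.symm⟩]
      rcases h2 with ⟨h2, h3⟩ | ⟨h2, h3⟩
      · rw [t3 h2]; exact h3.symm
      · rw [h3]; exact t4 h2
  have hedge : ∀ a b, cdg GG c (c s(a, b)) a ≠ cdg GG c (c s(a, b)) b →
      ∀ x y, (SimpleGraph.edge a b).Adj x y → cdg GG c (c s(x, y)) x ≠ cdg GG c (c s(x, y)) y := by
    intro a b h x y hxy
    rw [SimpleGraph.edge_adj] at hxy
    rcases hxy.1 with ⟨rfl, rfl⟩ | ⟨rfl, rfl⟩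
    · exact h
    · exact hsym _ _ h
  intro x y hxy
  rw [← hGG] at hxy
  simp only [SimpleGraph.sup_adj] at hxy
  rcases hxy with (((((((h | h) | h) | h) | h) | h) | h) | h) | h
  · by_cases h1 : x = u
    · subst h1; exact hu y h
    by_cases h2 : x = v
    · subst h2; exact hv y h
    by_cases h3 : y = u
    · subst h3; exact hsym _ _ (hu x h.symm)
    by_cases h4 : y = v
    · subst h4; exact hsym _ _ (hv x h.symm)
    rw [c00 _ _ h, dout _ x h1 h2 ⟨y, h⟩, dout _ y h3 h4 ⟨x, h.symm⟩]
    exact hE x y h h1 h2 h3 h4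
  · exact hedge _ _ (by rw [cA, dw1, dw2]; exact tA) x y h
  · exact hedge _ _ (by rw [cB, dw2, dz2]; exact tB) x y h
  · exact hedge _ _ (by rw [cC, dz2, dz1]; exact tC) x y h
  · exact hedge _ _ (by rw [cD, dz1, dw1]; exact tD) x y h
  · exact hedge _ _ (by rw [cE, du, dw1]; exact tE) x y h
  · exact hedge _ _ (by rw [cF, du, dz1]; exact tF) x y h
  · exact hedge _ _ (by rw [cH, dv, dw2]; exact tH) x y h
  · exact hedge _ _ (by rw [cI, dv, dz2]; exact tI) x y h

theorem nb_three {V : Type*} [Finite V] (G : SimpleGraph V) (hdeg : MaxDegreeLE G 3) {x a b c : V}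
    (ha : G.Adj x a) (hb : G.Adj x b) (hc : G.Adj x c) (hab : a ≠ b) (hac : a ≠ c) (hbc : b ≠ c) :
    ∀ y, G.Adj x y → y = a ∨ y = b ∨ y = c := by
  intro y hy
  have hsub : ({a, b, c} : Set V) ⊆ G.neighborSet x := by
    rintro z (rfl | rfl | rfl) <;> assumption
  have h3 : ({a, b, c} : Set V).ncard = 3 := Set.ncard_eq_three.2 ⟨a, b, c, hab, hac, hbc, rfl⟩
  have := Set.eq_of_subset_of_ncard_le hsub (by rw [h3]; exact hdeg x) (Set.toFinite _)
  have hy' : y ∈ G.neighborSet x := hy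
  rw [← this] at hy'
  exact hy'

theorem leaf_type {V : Type*} [Finite V] (E0 : SimpleGraph V) (c0 : Sym2 V → Fin 3)
    (u v : V) (huniq : ∀ y y', E0.Adj u y → E0.Adj u y' → y = y') :
    ∃ (t : Fin 3) (al : Fin 3), (∀ i, cdg E0 c0 i u = if t.castSucc = 0 then 0 else ind3 al i) ∧
    (∀ y, E0.Adj u y → y ≠ v → c0 s(u, y) = al ∧
      ((t.castSucc = 1 ∧ cdg E0 c0 al y ≠ 1) ∨ (t.castSucc = 2 ∧ cdg E0 c0 al y = 1))) := by
  by_cases h : ∃ y, E0.Adj u y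
  · obtain ⟨y, hy⟩ := h
    have h1 := cdg_uniq (c := c0) hy (fun z hz => huniq z y hz hy)
    by_cases h2 : cdg E0 c0 (c0 s(u, y)) y = 1
    · refine ⟨2, c0 s(u, y), fun i => by rw [h1]; rfl, fun z hz _ => ?_⟩
      rw [huniq z y hz hy]
      exact ⟨rfl, Or.inr ⟨rfl, h2⟩⟩
    · refine ⟨1, c0 s(u, y), fun i => by rw [h1]; rfl, fun z hz _ => ?_⟩
      rw [huniq z y hz hy]
      exact ⟨rfl, Or.inl ⟨rfl, h2⟩⟩
  · push Not at h
    exact ⟨0, 0, fun i => by rw [cdg_zero fun y hy => absurd hy (h y)]; rfl,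
      fun y hy => absurd hy (h y)⟩

theorem closed_conn {V : Type*} (G : SimpleGraph V) (hconn : G.Connected) (S : Set V) (u : V)
    (hu : u ∈ S) (hcl : ∀ a b, G.Adj a b → a ∈ S → b ∈ S) (x : V) : x ∈ S := by
  obtain ⟨p⟩ := hconn.preconnected x u
  induction p with
  | nil => exact hu
  | cons h p ih => exact hcl _ _ h.symm (ih hu)

/-- In a minimal counterexample to the 3-color theorem for claw-free subcubic graphs, there is no 4-cycle `w₁ w₂ z₂ z₁` sharing an edge with each of two triangles `u w₁ z₁` and `v w₂ z₂`. -/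
theorem minimal_cex_no_C4_two_triangles {V : Type*} [Fintype V] (G : SimpleGraph V)
    (hconn : G.Connected) (hdec : Decomposable G) (hclaw : ClawFree G)
    (hdeg : MaxDegreeLE G 3) (hG : ¬ HasLIEC G 3)
    (hmin : ∀ (W : Type) [Fintype W] (H : SimpleGraph W),
      Decomposable H → ClawFree H → MaxDegreeLE H 3 →
      H.edgeSet.ncard < G.edgeSet.ncard → HasLIEC H 3) :
    ¬ ∃ u v w1 w2 z1 z2 : V, List.Pairwise (· ≠ ·) [u, v, w1, w2, z1, z2] ∧
      G.Adj w1 w2 ∧ G.Adj w2 z2 ∧ G.Adj z2 z1 ∧ G.Adj z1 w1 ∧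
      G.Adj u w1 ∧ G.Adj u z1 ∧ G.Adj v w2 ∧ G.Adj v z2 := by
  classical
  rintro ⟨u, v, w1, w2, z1, z2, hd, a12, awz2, az, azw1, auw, auz, avw, avz⟩
  have hd' := hd
  simp only [List.pairwise_cons, List.mem_cons, List.not_mem_nil, or_false, forall_eq_or_imp,
    forall_eq, IsEmpty.forall_iff, implies_true, List.Pairwise.nil, and_true] at hd'
  obtain ⟨⟨uv, uw1, uw2, uz1, uz2⟩, ⟨vw1, vw2, vz1, vz2⟩, ⟨w12, w1z1, w1z2⟩, ⟨w2z1, w2z2⟩, z12⟩ := hd'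
  obtain ⟨R, hR⟩ : ∃ R : Set (Sym2 V), R = {s(w1, w2), s(w2, z2), s(z2, z1), s(z1, w1), s(u, w1),
    s(u, z1), s(v, w2), s(v, z2)} := ⟨_, rfl⟩
  obtain ⟨E0, hE0⟩ : ∃ E0 : SimpleGraph V, E0 = G.deleteEdges R := ⟨_, rfl⟩
  have eadj : ∀ x y, E0.Adj x y ↔ G.Adj x y ∧ s(x, y) ∉ R := by
    intro x y; rw [hE0, SimpleGraph.deleteEdges_adj]
  have hle : E0 ≤ G := fun x y h => ((eadj x y).1 h).1
  -- neighbours of the block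
  have nw1 : ∀ y, ¬ E0.Adj w1 y := by
    intro y hy
    rw [eadj, hR] at hy
    rcases nb_three G hdeg a12 azw1.symm auw.symm w2z1 uw2.symm uz1.symm y hy.1 with rfl | rfl | rfl <;>
      simp at hy
  have nw2 : ∀ y, ¬ E0.Adj w2 y := by
    intro y hy
    rw [eadj, hR] at hy
    rcases nb_three G hdeg a12.symm awz2 avw.symm w1z2 vw1.symm vz2.symm y hy.1 with rfl | rfl | rfl <;>
      simp at hy
  have nz1 : ∀ y, ¬ E0.Adj z1 y := by
    intro y hy
    rw [eadj, hR] at hy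
    rcases nb_three G hdeg az.symm azw1 auz.symm w1z2.symm uz2.symm uw1.symm y hy.1 with rfl | rfl | rfl <;>
      simp at hy
  have nz2 : ∀ y, ¬ E0.Adj z2 y := by
    intro y hy
    rw [eadj, hR] at hy
    rcases nb_three G hdeg az awz2.symm avz.symm w2z1.symm vz1.symm vw2.symm y hy.1 with rfl | rfl | rfl <;>
      simp at hy
  have huniq : ∀ y y', E0.Adj u y → E0.Adj u y' → y = y' := by
    intro y y' hy hy'
    have h1 : w1 ≠ y := by rintro rfl; exact nw1 _ hy.symm
    have h2 : z1 ≠ y := by rintro rfl; exact nz1 _ hy.symm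
    rcases nb_three G hdeg auw auz (hle hy) w1z1 h1 h2 y' (hle hy') with rfl | rfl | rfl
    · exact absurd hy'.symm (nw1 _)
    · exact absurd hy'.symm (nz1 _)
    · rfl
  have hvniq : ∀ y y', E0.Adj v y → E0.Adj v y' → y = y' := by
    intro y y' hy hy'
    have h1 : w2 ≠ y := by rintro rfl; exact nw2 _ hy.symm
    have h2 : z2 ≠ y := by rintro rfl; exact nz2 _ hy.symm
    rcases nb_three G hdeg avw avz (hle hy) w2z2 h1 h2 y' (hle hy') with rfl | rfl | rfl
    · exact absurd hy'.symm (nw2 _)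
    · exact absurd hy'.symm (nz2 _)
    · rfl
  have hdegE : MaxDegreeLE E0 3 := fun x =>
    (Set.ncard_le_ncard (fun y (hy : E0.Adj x y) => hle hy) (Set.toFinite _)).trans (hdeg x)
  -- G is rebuilt from E0
  have hedge : ∀ a b, G.Adj a b → SimpleGraph.edge a b ≤ G := by
    intro a b hab x y hxy
    rw [SimpleGraph.edge_adj] at hxy
    rcases hxy.1 with ⟨rfl, rfl⟩ | ⟨rfl, rfl⟩
    · exact hab
    · exact hab.symm
  have hGeq : E0 ⊔ SimpleGraph.edge w1 w2 ⊔ SimpleGraph.edge w2 z2 ⊔ SimpleGraph.edge z2 z1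
        ⊔ SimpleGraph.edge z1 w1 ⊔ SimpleGraph.edge u w1 ⊔ SimpleGraph.edge u z1
        ⊔ SimpleGraph.edge v w2 ⊔ SimpleGraph.edge v z2 = G := by
    apply le_antisymm
    · exact sup_le (sup_le (sup_le (sup_le (sup_le (sup_le (sup_le (sup_le hle
        (hedge _ _ a12)) (hedge _ _ awz2)) (hedge _ _ az)) (hedge _ _ azw1)) (hedge _ _ auw))
        (hedge _ _ auz)) (hedge _ _ avw)) (hedge _ _ avz)
    · intro x y hxy
      have e_of : ∀ a b, s(x, y) = s(a, b) → (SimpleGraph.edge a b).Adj x y := by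
        intro a b h
        rw [SimpleGraph.edge_adj]
        exact ⟨Sym2.eq_iff.1 h, hxy.ne⟩
      simp only [SimpleGraph.sup_adj]
      by_cases h : s(x, y) ∈ R
      · rw [hR] at h
        simp only [Set.mem_insert_iff, Set.mem_singleton_iff] at h
        rcases h with h | h | h | h | h | h | h | h <;> have h' := e_of _ _ h <;>
          simp only [h', true_or, or_true]
      · have h' := (eadj x y).2 ⟨hxy, h⟩
        simp only [h', true_or]
  have hblock : ∀ a b, s(a, b) ∈ R → b ∈ ({u, v, w1, w2, z1, z2} : Set V) := by
    intro a b h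
    rw [hR] at h
    simp only [Set.mem_insert_iff, Set.mem_singleton_iff, Sym2.eq_iff] at h ⊢
    rcases h with (⟨_, h⟩ | ⟨_, h⟩) | (⟨_, h⟩ | ⟨_, h⟩) | (⟨_, h⟩ | ⟨_, h⟩) | (⟨_, h⟩ | ⟨_, h⟩) |
      (⟨_, h⟩ | ⟨_, h⟩) | (⟨_, h⟩ | ⟨_, h⟩) | (⟨_, h⟩ | ⟨_, h⟩) | (⟨_, h⟩ | ⟨_, h⟩) <;>
      simp only [h, true_or, or_true]
  apply hG
  rw [← hGeq]
  by_cases huv : E0.Adj u v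
  · -- prism
    have hu1 := cdg_uniq (c := fun _ : Sym2 V => (0 : Fin 3)) huv (fun z hz => huniq z v hz huv)
    have hv1 := cdg_uniq (c := fun _ : Sym2 V => (0 : Fin 3)) huv.symm
      (fun z hz => hvniq z u hz huv.symm)
    refine finish_block E0 (fun _ => 0) u v w1 w2 z1 z2 hd nw1 nw2 nz1 nz2 3 3 0 0 0 0 1 0 0 1 2 2
      table_prism (fun i => by rw [hu1]; rfl) (fun i => by rw [hv1]; rfl) ?_ ?_ ?_ (fun _ => ⟨rfl, rfl, rfl⟩)
    · intro x y hxy h1 h2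
      exfalso
      have key : x ∈ ({u, v, w1, w2, z1, z2} : Set V) := by
        apply closed_conn G hconn _ u (by simp)
        intro a b hab ha
        by_cases hb : s(a, b) ∈ R
        · exact hblock a b hb
        have eab := (eadj a b).2 ⟨hab, hb⟩
        simp only [Set.mem_insert_iff, Set.mem_singleton_iff] at ha ⊢
        rcases ha with rfl | rfl | rfl | rfl | rfl | rfl
        · exact Or.inr (Or.inl (huniq b v eab huv))
        · exact Or.inl (hvniq b u eab huv.symm)
        · exact absurd eab (nw1 b)
        · exact absurd eab (nw2 b)
        · exact absurd eab (nz1 b)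
        · exact absurd eab (nz2 b)
      simp only [Set.mem_insert_iff, Set.mem_singleton_iff] at key
      rcases key with rfl | rfl | rfl | rfl | rfl | rfl
      · exact h1 rfl
      · exact h2 rfl
      · exact nw1 y hxy
      · exact nw2 y hxy
      · exact nz1 y hxy
      · exact nz2 y hxy
    · intro y hy hne; exact absurd (huniq y v hy huv) hne
    · intro y hy hne; exact absurd (hvniq y u hy huv.symm) hne
  · -- general case
    have hreach : ∀ x, (∀ y, ¬ E0.Adj x y) ∨ E0.Reachable x u ∨ E0.Reachable x v := by
      intro x
      have key : x ∈ {x | (∀ y, ¬ E0.Adj x y) ∨ E0.Reachable x u ∨ E0.Reachable x v} := by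
        apply closed_conn G hconn _ u
        · exact Or.inr (Or.inl (SimpleGraph.Reachable.refl _))
        intro a b hab ha
        by_cases hb : s(a, b) ∈ R
        · have := hblock a b hb
          simp only [Set.mem_insert_iff, Set.mem_singleton_iff] at this
          rcases this with rfl | rfl | rfl | rfl | rfl | rfl
          · exact Or.inr (Or.inl (SimpleGraph.Reachable.refl _))
          · exact Or.inr (Or.inr (SimpleGraph.Reachable.refl _))
          · exact Or.inl nw1
          · exact Or.inl nw2
          · exact Or.inl nz1
          · exact Or.inl nz2
        have eab := (eadj a b).2 ⟨hab, hb⟩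
        rcases ha with ha | ha | ha
        · exact absurd eab (ha b)
        · exact Or.inr (Or.inl (eab.symm.reachable.trans ha))
        · exact Or.inr (Or.inr (eab.symm.reachable.trans ha))
      exact key
    obtain ⟨f, hf, hpar⟩ := exists_orient E0 u v hreach
    obtain ⟨H, hH⟩ : ∃ H : SimpleGraph V, H = E0.deleteEdges {e | f e = u ∨ f e = v} := ⟨_, rfl⟩
    have hadj : ∀ x y, H.Adj x y ↔ E0.Adj x y ∧ ¬ (f s(x, y) = u ∨ f s(x, y) = v) := by
      intro x y; rw [hH, SimpleGraph.deleteEdges_adj]; rfl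
    have hHE : H ≤ E0 := fun x y h => ((hadj x y).1 h).1
    have hkeep : ∀ x y, E0.Adj x y → x ≠ u → x ≠ v → y ≠ u → y ≠ v → H.Adj x y := by
      intro x y hxy h1 h2 h3 h4
      rw [hadj]
      refine ⟨hxy, ?_⟩
      have := hf s(x, y) hxy
      rw [Sym2.mem_iff] at this
      rcases this with h | h <;> rw [h]
      · exact fun h' => h'.elim h1 h2
      · exact fun h' => h'.elim h3 h4
    have hHdec : Decomposable H := by
      apply dec_of_orient H f (fun e he => hf e (SimpleGraph.edgeSet_mono hHE he))
      intro x
      by_cases hx : x = u ∨ x = v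
      · rw [Finset.filter_false_of_mem]
        · simp
        · intro e _ he
          obtain ⟨he, hfe⟩ := he
          induction e using Sym2.ind with
          | _ p q =>
            have := ((hadj p q).1 he).2
            rw [hfe] at this
            exact this hx
      · have h0 := hpar x (fun h => hx (Or.inl h)) (fun h => hx (Or.inr h))
        rw [par_eq] at h0
        convert h0 using 2
        ext e
        simp only [Finset.mem_filter, Finset.mem_univ, true_and]
        induction e using Sym2.ind with
        | _ p q =>
          rw [SimpleGraph.mem_edgeSet, SimpleGraph.mem_edgeSet, hadj]
          constructor
          · rintro ⟨h1, h2⟩; exact ⟨h1.1, h2⟩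
          · rintro ⟨h1, h2⟩; exact ⟨⟨h1, by rw [h2]; exact hx⟩, h2⟩
    have htri : ∀ x a b, H.Adj x a → H.Adj x b → G.Adj a b → H.Adj a b := by
      intro x a b hxa hxb hab
      have ea := hHE hxa
      have eb := hHE hxb
      have b1 : a ≠ w1 := by rintro rfl; exact nw1 _ ea.symm
      have b2 : a ≠ w2 := by rintro rfl; exact nw2 _ ea.symm
      have b3 : a ≠ z1 := by rintro rfl; exact nz1 _ ea.symm
      have b4 : a ≠ z2 := by rintro rfl; exact nz2 _ ea.symm
      have b5 : b ≠ w1 := by rintro rfl; exact nw1 _ eb.symm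
      have b6 : b ≠ w2 := by rintro rfl; exact nw2 _ eb.symm
      have b7 : b ≠ z1 := by rintro rfl; exact nz1 _ eb.symm
      have b8 : b ≠ z2 := by rintro rfl; exact nz2 _ eb.symm
      have eab : E0.Adj a b := by
        rw [eadj]
        refine ⟨hab, ?_⟩
        rw [hR]
        simp [b1, b2, b3, b4, b5, b6, b7, b8]
      apply hkeep a b eab
      · rintro rfl; exact eb.ne (huniq x b ea.symm eab)
      · rintro rfl; exact eb.ne (hvniq x b ea.symm eab)
      · rintro rfl; exact ea.ne (huniq x a eb.symm eab.symm)
      · rintro rfl; exact ea.ne (hvniq x a eb.symm eab.symm)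
    have hHclaw : ClawFree H := by
      rintro ⟨x, a, b, c, h1, h2, h3, ha, hb, hc, h4, h5, h6⟩
      exact hclaw ⟨x, a, b, c, h1, h2, h3, hle (hHE ha), hle (hHE hb), hle (hHE hc),
        fun h => h4 (htri x a b ha hb h), fun h => h5 (htri x a c ha hc h),
        fun h => h6 (htri x b c hb hc h)⟩
    have hHdeg : MaxDegreeLE H 3 := fun x =>
      (Set.ncard_le_ncard (fun y (hy : H.Adj x y) => hHE hy) (Set.toFinite _)).trans (hdegE x)
    have hcard : H.edgeSet.ncard < G.edgeSet.ncard := by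
      apply Set.ncard_lt_ncard _ (Set.toFinite _)
      refine ⟨SimpleGraph.edgeSet_mono (hHE.trans hle), fun h => ?_⟩
      have : s(w1, w2) ∈ H.edgeSet := h a12
      exact nw1 _ (hHE this)
    have hL := min_transfer _ hmin H hHdec hHclaw hHdeg hcard
    rw [liec_iff] at hL
    obtain ⟨c, hc⟩ := hL
    have g0 : GoodC H {u, v} c := fun x y hxy => Or.inl (hc x y hxy)
    obtain ⟨K1, c1, k1, k1', k1u, g1⟩ := good_step E0 H {u, v} c u (by simp) huniq hdegE hHE g0
    obtain ⟨K2, c0, k2, k2', k2v, g2⟩ := good_step E0 K1 {u, v} c1 v (by simp) hvniq hdegE k1' g1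
    have hK2 : K2 = E0 := by
      apply le_antisymm k2'
      intro x y hxy
      by_cases h1 : x = u
      · subst h1; exact k2 (k1u y hxy)
      by_cases h2 : x = v
      · subst h2; exact k2v y hxy
      by_cases h3 : y = u
      · subst h3; exact (k2 (k1u x hxy.symm)).symm
      by_cases h4 : y = v
      · subst h4; exact (k2v x hxy.symm).symm
      exact k2 (k1 (hkeep x y hxy h1 h2 h3 h4))
    rw [hK2] at g2
    obtain ⟨tu, al, hu1, hu2⟩ := leaf_type E0 c0 u v huniq
    obtain ⟨tv, be, hv1, hv2⟩ := leaf_type E0 c0 v u hvniq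
    obtain ⟨t, _, ht⟩ := table_all al be tu tv
    refine finish_block E0 c0 u v w1 w2 z1 z2 hd nw1 nw2 nz1 nz2 _ _ _ _ _ _ _ _ _ _ _ _ ht
      hu1 hv1 ?_ hu2 hv2 (fun h => absurd h huv)
    intro x y hxy h1 h2 h3 h4
    rcases g2 x y hxy with h | ⟨h, _⟩
    · exact h
    · simp only [Set.mem_insert_iff, Set.mem_singleton_iff] at h
      rcases h with (h | h) | (h | h)
      · exact absurd h h1
      · exact absurd h h2
      · exact absurd h h3
      · exact absurd h h4
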